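/- Assume Martin's Axiom. Then there exists a family {F_ξ : ξ < 2^ℵ₀} of 2^ℵ₀ many free filters on ℕ, each of which is non-μ-measurable as a subset of 2^ℕ, such that for every uncountable set X ⊆ 2^ℵ₀ the intersection ⋂_{ξ ∈ X} F_ξ is a μ-measurable filter. In particular, Martin's Axiom implies there is a family of ℵ₁ many nonmeasurable free filters on ℕ whose intersection is measurable. -/

import Mathlib

open Filter Set MeasureTheory

/-- The subset of the Cantor space `ℕ → Bool` corresponding to a filter `F` on `ℕ`,
identifying a subset of `ℕ` with its characteristic function. -/
def filterSet (F : Filter ℕ) : Set (ℕ → Bool) :=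
  {x | {n | x n = true} ∈ F}

/-- `μ` is the fair-coin product measure on the Cantor space: every cylinder determined by
finitely many coordinates has the expected measure `(1/2)^(number of coordinates)`. -/
def IsCoinMeasure (μ : Measure (ℕ → Bool)) : Prop :=
  ∀ (s : Finset ℕ) (f : ℕ → Bool), μ {x | ∀ i ∈ s, x i = f i} = (2 : ENNReal)⁻¹ ^ s.card

/-- Two conditions of a partial order are incompatible if they have no common extension. -/
def Incompatible {P : Type} [PartialOrder P] (p q : P) : Prop :=
  ¬ ∃ r : P, r ≤ p ∧ r ≤ q

/-- A partial order is ccc if every antichain (set of pairwise incompatible elements)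
is countable. -/
def CCC (P : Type) [PartialOrder P] : Prop :=
  ∀ A : Set P, A.Pairwise Incompatible → A.Countable

/-- A subset of a partial order is dense (in the forcing sense) if every element has an
extension in it. -/
def ForcingDense {P : Type} [PartialOrder P] (d : Set P) : Prop :=
  ∀ p : P, ∃ q ∈ d, q ≤ p

/-- A filter on a partial order (in the forcing sense): a nonempty, upward closed,
downward directed set. -/
def ForcingFilter {P : Type} [PartialOrder P] (G : Set P) : Prop :=
  G.Nonempty ∧ (∀ p ∈ G, ∀ q : P, p ≤ q → q ∈ G) ∧
    ∀ p ∈ G, ∀ q ∈ G, ∃ r ∈ G, r ≤ p ∧ r ≤ q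

/-- Martin's Axiom: for every nonempty ccc partial order `P` and every family `D` of fewer
than `2^ℵ₀` dense subsets of `P`, there is a filter on `P` meeting every member of `D`. -/
def MartinsAxiom : Prop :=
  ∀ (P : Type) [PartialOrder P], Nonempty P → CCC P →
    ∀ D : Set (Set P), Cardinal.mk D < Cardinal.continuum → (∀ d ∈ D, ForcingDense d) →
      ∃ G : Set P, ForcingFilter G ∧ ∀ d ∈ D, (G ∩ d).Nonempty

open Topology

/-- The set of natural numbers `A` has asymptotic density `d`. -/
def HasDensity (A : Set ℕ) (d : ℝ) : Prop :=
  Tendsto (fun n : ℕ => (∑ i ∈ Finset.range n, A.indicator (1 : ℕ → ℝ) i) / n) atTop (𝓝 d)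

namespace HasDensity

lemma univ : HasDensity Set.univ 1 := by
  refine tendsto_const_nhds.congr' ?_
  filter_upwards [eventually_ne_atTop 0] with n hn
  have : (n : ℝ) ≠ 0 := by exact_mod_cast hn
  simp [this]

lemma empty : HasDensity ∅ 0 := by
  simp [HasDensity]

lemma diff {A B : Set ℕ} {d e : ℝ} (hA : HasDensity A d) (hB : HasDensity B e) (h : B ⊆ A) :
    HasDensity (A \ B) (d - e) := by
  refine (hA.sub hB).congr fun n => ?_
  rw [← sub_div, ← Finset.sum_sub_distrib]
  simp only [indicator_sdiff h, Pi.sub_apply]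

lemma compl {A : Set ℕ} {d : ℝ} (hA : HasDensity A d) : HasDensity Aᶜ (1 - d) := by
  rw [compl_eq_univ_sdiff]
  exact univ.diff hA (subset_univ _)

/-- Density is monotone with respect to inclusion up to finitely many points. -/
lemma le_of_eventually {A B : Set ℕ} {d e : ℝ} (hA : HasDensity A d) (hB : HasDensity B e)
    (h : ∀ᶠ n in cofinite, n ∈ A → n ∈ B) : d ≤ e := by
  rw [Nat.cofinite_eq_atTop, eventually_atTop] at h
  obtain ⟨N, hN⟩ := h
  have key : Tendsto (fun n : ℕ =>
      (∑ i ∈ Finset.range n, B.indicator (1 : ℕ → ℝ) i) / n + (N : ℝ) / n) atTop (𝓝 (e + 0)) :=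
    hB.add (tendsto_const_div_atTop_nhds_zero_nat _)
  rw [add_zero] at key
  refine le_of_tendsto_of_tendsto' hA key fun n => ?_
  rw [← add_div]
  refine div_le_div_of_nonneg_right ?_ n.cast_nonneg
  induction n with
  | zero => simp
  | succ n ih =>
    rw [Finset.sum_range_succ, Finset.sum_range_succ]
    by_cases hn : N ≤ n
    · have : A.indicator (1 : ℕ → ℝ) n ≤ B.indicator (1 : ℕ → ℝ) n := by
        by_cases hA : n ∈ A
        · simp [hA, hN n hn hA]
        · simp [hA, indicator_nonneg]
      linarith
    · have h1 : ∑ i ∈ Finset.range n, A.indicator (1 : ℕ → ℝ) i +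
          A.indicator (1 : ℕ → ℝ) n ≤ N := by
        rw [← Finset.sum_range_succ]
        calc _ ≤ ∑ i ∈ Finset.range (n + 1), (1 : ℝ) :=
              Finset.sum_le_sum fun i _ =>
                indicator_le_self' (f := (1 : ℕ → ℝ)) (fun _ _ => zero_le_one) i
          _ ≤ N := by
            simp only [Finset.sum_const, Finset.card_range, nsmul_eq_mul, mul_one]
            exact_mod_cast Nat.lt_of_not_le hn
      have h2 : 0 ≤ ∑ i ∈ Finset.range n, B.indicator (1 : ℕ → ℝ) i +
          B.indicator (1 : ℕ → ℝ) n :=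
        add_nonneg (Finset.sum_nonneg fun i _ => indicator_nonneg (by simp) i)
          (indicator_nonneg (by simp) n)
      linarith

lemma unique {A : Set ℕ} {d e : ℝ} (hA : HasDensity A d) (hB : HasDensity A e) : d = e :=
  tendsto_nhds_unique hA hB

lemma of_finite {A : Set ℕ} (hA : A.Finite) : HasDensity A 0 := by
  have key : Tendsto (fun n : ℕ => (hA.toFinset.card : ℝ) / n) atTop (𝓝 0) :=
    tendsto_const_div_atTop_nhds_zero_nat _
  refine squeeze_zero (fun n => div_nonneg
    (Finset.sum_nonneg fun i _ => indicator_nonneg (by simp) i) n.cast_nonneg)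
    (fun n => div_le_div_of_nonneg_right ?_ n.cast_nonneg) key
  classical
  rw [Finset.sum_indicator_eq_sum_filter]
  simp only [Pi.one_apply, Finset.sum_const, nsmul_eq_mul, mul_one, Nat.cast_le]
  exact Finset.card_le_card fun i hi => by simpa using (Finset.mem_filter.1 hi).2

end HasDensity

open Classical in
lemma sum_range_indicator_eq_sum_nth (b : Set ℕ) (f : ℕ → ℝ) (n : ℕ) :
    ∑ i ∈ Finset.range n, b.indicator f i =
      ∑ k ∈ Finset.range (Nat.count (· ∈ b) n), f (Nat.nth (· ∈ b) k) := by
  induction n with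
  | zero => simp
  | succ n ih =>
    rw [Finset.sum_range_succ, ih, Nat.count_succ]
    by_cases h : n ∈ b
    · simp [h, Finset.sum_range_succ, Nat.nth_count (p := (· ∈ b)) h]
    · simp [h]

/-- The fair-coin product measure on the Cantor space. -/
noncomputable def coinProduct : Measure (ℕ → Bool) :=
  Measure.infinitePi fun _ => (PMF.uniformOfFintype Bool).toMeasure

lemma IsCoinMeasure.eq_coinProduct {μ : Measure (ℕ → Bool)} (hμ : IsCoinMeasure μ) :
    μ = coinProduct := by
  refine IsProjectiveLimit.unique (fun s => ?_) (Measure.isProjectiveLimit_infinitePi _)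
  refine Measure.ext_of_singleton fun f => ?_
  rw [Measure.map_apply (by fun_prop) (measurableSet_singleton f), Measure.pi_singleton]
  have := hμ s (fun i => if h : i ∈ s then f ⟨i, h⟩ else true)
  convert this using 1
  · congr 1
    ext x
    simp only [mem_preimage, mem_singleton_iff, funext_iff, Subtype.forall, mem_ofPred_eq]
    refine forall₂_congr fun i hi => ?_
    simp [hi, Finset.restrict]
  · simp

lemma IsCoinMeasure.measurePreserving_not {μ : Measure (ℕ → Bool)} (hμ : IsCoinMeasure μ) :
    MeasurePreserving (fun (x : ℕ → Bool) n => !x n) μ μ := by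
  have hm : Measurable (fun (x : ℕ → Bool) n => !x n) :=
    measurable_pi_lambda _ fun n =>
      (measurable_of_countable fun c : Bool => !c).comp (measurable_pi_apply n)
  refine ⟨hm, ?_⟩
  rw [hμ.eq_coinProduct]
  refine IsCoinMeasure.eq_coinProduct fun s f => ?_
  rw [← hμ.eq_coinProduct, Measure.map_apply hm]
  · rw [← hμ s (fun i => !f i)]
    congr 1
    ext x
    simp [Bool.not_eq_eq_eq_not]
  · rw [ofPred_forall]
    refine MeasurableSet.iInter fun i => ?_
    by_cases hi : i ∈ s
    · have : MeasurableSet {x : ℕ → Bool | x i = f i} :=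
        measurableSet_eq_fun (by fun_prop) measurable_const
      simpa only [hi, forall_const] using this
    · simp [hi]

/-- Almost every subset of `ℕ` splits a given set having a density into halves. -/
lemma IsCoinMeasure.ae_hasDensity_inter {μ : Measure (ℕ → Bool)} (hμ : IsCoinMeasure μ)
    {b : Set ℕ} {d : ℝ} (hb : HasDensity b d) :
    ∀ᵐ x ∂μ, HasDensity ({n | x n = true} ∩ b) (2⁻¹ * d) := by
  classical
  rcases b.finite_or_infinite with hfin | hinf
  · refine .of_forall fun x => ?_
    rw [hb.unique (.of_finite hfin), mul_zero]
    exact .of_finite (hfin.subset inter_subset_right)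
  obtain rfl := hμ.eq_coinProduct
  let g : Bool → ℝ := fun c => if c then 1 else 0
  have hg : Measurable g := measurable_of_countable g
  have hgx : ∀ i, Measurable fun x : ℕ → Bool => g (x i) :=
    fun i => hg.comp (measurable_pi_apply i)
  have heval : ∀ i, MeasurePreserving (Function.eval i) coinProduct
      (PMF.uniformOfFintype Bool).toMeasure := measurePreserving_eval_infinitePi _
  have hindep : ProbabilityTheory.iIndepFun (fun i (x : ℕ → Bool) => g (x i)) coinProduct :=
    ProbabilityTheory.iIndepFun_infinitePi fun _ => hg
  have hint : ∫ x, g (x (Nat.nth (· ∈ b) 0)) ∂coinProduct = 2⁻¹ := by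
    have := integral_map (heval (Nat.nth (· ∈ b) 0)).measurable.aemeasurable
      (μ := coinProduct) (f := g) hg.aestronglyMeasurable
    rw [(heval _).map_eq] at this
    rw [← this, PMF.integral_eq_sum]
    simp [g]
  have hslln := ProbabilityTheory.strong_law_ae_real
    (fun k (x : ℕ → Bool) => g (x (Nat.nth (· ∈ b) k))) (μ := coinProduct) ?_
    (fun i j hij => hindep.indepFun fun h => hij (Nat.nth_injective hinf h))
    (fun i => ?_)
  · rw [hint] at hslln
    filter_upwards [hslln] with x hx
    have hcount : Tendsto (fun n => Nat.count (· ∈ b) n) atTop atTop := by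
      refine tendsto_atTop_atTop_of_monotone (Nat.count_monotone _) fun m => ?_
      exact ⟨Nat.nth (· ∈ b) m, (Nat.count_nth_of_infinite (p := (· ∈ b)) hinf m).ge⟩
    refine ((hx.comp hcount).mul hb).congr fun n => ?_
    have h1 : ∑ i ∈ Finset.range n, b.indicator (1 : ℕ → ℝ) i = Nat.count (· ∈ b) n := by
      simp [sum_range_indicator_eq_sum_nth]
    have h2 : ({n | x n = true} ∩ b).indicator (1 : ℕ → ℝ) = b.indicator fun i => g (x i) := by
      ext i
      by_cases hi : i ∈ b <;> by_cases hx : x i = true <;> simp [hi, hx, g]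
    rw [h1, h2, sum_range_indicator_eq_sum_nth, Function.comp_apply]
    rcases eq_or_ne (Nat.count (· ∈ b) n) 0 with h0 | h0
    · simp [h0]
    · have : (Nat.count (· ∈ b) n : ℝ) ≠ 0 := by exact_mod_cast h0
      field_simp
  · have : IsProbabilityMeasure coinProduct := by unfold coinProduct; infer_instance
    refine Integrable.of_bound (hgx _).aestronglyMeasurable 1 (.of_forall fun x => ?_)
    simp only [g]
    split_ifs <;> simp
  · refine ⟨(hgx _).aemeasurable, (hgx _).aemeasurable, ?_⟩
    have hmap : ∀ j, Measure.map (fun x : ℕ → Bool => g (x j)) coinProduct =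
        (PMF.uniformOfFintype Bool).toMeasure.map g := fun j => by
      rw [← (heval j).map_eq, Measure.map_map hg (measurable_pi_apply j)]
      rfl
    rw [hmap, hmap]

/-- The density analogue of mutual independence for sets of natural numbers of density `1/2`. -/
def DensityIndependent {J : Type*} (Y : J → Set ℕ) : Prop :=
  ∀ s : Finset J, HasDensity (⋂ j ∈ s, Y j) (2⁻¹ ^ s.card)

lemma DensityIndependent.inter_compl {J ι : Type*} {Y : J → Set ℕ} (hY : DensityIndependent Y)
    (t : ι → Finset J) (ht : Pairwise (Function.onFun Disjoint t)) (I : Finset ι) :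
    ∀ s : Finset J, (∀ i ∈ I, Disjoint s (t i)) →
      HasDensity ((⋂ j ∈ s, Y j) ∩ ⋂ i ∈ I, (⋂ j ∈ t i, Y j)ᶜ)
        (2⁻¹ ^ s.card * ∏ i ∈ I, (1 - 2⁻¹ ^ (t i).card)) := by
  classical
  induction I using Finset.induction_on with
  | empty => intro s _; simpa using hY s
  | insert a I ha ih =>
    intro s hs
    have h1 := ih s fun i hi => hs i (Finset.mem_insert_of_mem hi)
    have h2 := ih (s ∪ t a) fun i hi => Finset.disjoint_union_left.2
      ⟨hs i (Finset.mem_insert_of_mem hi), ht fun h => ha (h ▸ hi)⟩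
    have h3 := h1.diff h2 (inter_subset_inter_left _
      (biInter_subset_biInter_left fun j hj => Finset.mem_union_left _ hj))
    convert h3 using 1
    · ext n
      simp only [mem_inter_iff, mem_iInter, Set.mem_sdiff, Finset.mem_insert, Finset.mem_union,
        mem_compl_iff]
      grind
    · rw [Finset.prod_insert ha,
        Finset.card_union_of_disjoint (hs a (Finset.mem_insert_self _ _)), pow_add]
      ring

/-- Under Martin's Axiom, fewer than continuum many almost sure properties hold simultaneously
at some point of any given set of positive measure. -/
lemma MartinsAxiom.exists_mem_forall (hMA : MartinsAxiom) {μ : Measure (ℕ → Bool)}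
    [IsFiniteMeasure μ] {K : Set (ℕ → Bool)} (hK : MeasurableSet K) (hK0 : μ K ≠ 0)
    {S : Type} (hS : Cardinal.mk S < Cardinal.continuum) {p : S → (ℕ → Bool) → Prop}
    (hp : ∀ s, ∀ᵐ x ∂μ, p s x) : ∃ x ∈ K, ∀ s, p s x := by
  let P := {C : Set (ℕ → Bool) // IsClosed C ∧ C ⊆ K ∧ μ C ≠ 0}
  have hsub : ∀ A ⊆ K, MeasurableSet A → μ A ≠ 0 → ∃ C : P, C.1 ⊆ A := by
    intro A hAK hA h0
    obtain ⟨C, hCA, hC, hC0⟩ :=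
      hA.exists_lt_isClosed_of_ne_top (measure_ne_top μ A) (pos_iff_ne_zero.2 h0)
    exact ⟨⟨C, hC, hCA.trans hAK, hC0.ne'⟩, hCA⟩
  have hne : Nonempty P := ⟨(hsub K subset_rfl hK hK0).choose⟩
  have hccc : CCC P := by
    intro A hA
    have key := Measure.countable_meas_pos_of_disjoint_iUnion₀ (μ := μ)
      (As := fun C : A => C.1.1) (fun C => C.1.2.1.measurableSet.nullMeasurableSet) ?_
    · have huniv : {C : A | 0 < μ C.1.1} = Set.univ :=
        eq_univ_of_forall fun C => pos_iff_ne_zero.2 C.1.2.2.2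
      rw [huniv, countable_univ_iff] at key
      exact key
    · intro C D hCD
      by_contra h0
      refine hA C.2 D.2 (fun h => hCD (Subtype.ext h)) ?_
      exact ⟨⟨C.1.1 ∩ D.1.1, C.1.2.1.inter D.1.2.1, inter_subset_left.trans C.1.2.2.1, h0⟩,
        inter_subset_left, inter_subset_right⟩
  let d : S → Set P := fun s => {C | ∀ x ∈ C.1, p s x}
  have hd : ∀ s, ForcingDense (d s) := by
    intro s C
    have h0 : μ (toMeasurable μ {x | ¬ p s x}) = 0 := by
      rw [measure_toMeasurable]
      exact hp s
    obtain ⟨D, hD⟩ := hsub (C.1 \ toMeasurable μ {x | ¬ p s x})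
      (sdiff_subset.trans C.2.2.1)
      (C.2.1.measurableSet.diff (measurableSet_toMeasurable _ _))
      (by rw [measure_sdiff_null h0]; exact C.2.2.2)
    refine ⟨D, fun x hx => ?_, hD.trans sdiff_subset⟩
    by_contra hpx
    exact (hD hx).2 (subset_toMeasurable μ {x | ¬ p s x} hpx)
  obtain ⟨G, ⟨hG, -, hdir⟩, hGd⟩ := hMA P hne hccc (range d) (Cardinal.mk_range_le.trans_lt hS)
    (by rintro _ ⟨s, rfl⟩; exact hd s)
  have := hG.to_subtype
  obtain ⟨x, hx⟩ := IsCompact.nonempty_iInter_of_directed_nonempty_isCompact_isClosed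
    (fun C : G => C.1.1)
    (fun C D => by
      obtain ⟨E, hE, hEC, hED⟩ := hdir C.1 C.2 D.1 D.2
      exact ⟨⟨E, hE⟩, hEC, hED⟩)
    (fun C => nonempty_of_measure_ne_zero C.1.2.2.2)
    (fun C => C.1.2.1.isCompact) (fun C => C.1.2.1)
  rw [mem_iInter] at hx
  obtain ⟨C, hC⟩ := hG
  refine ⟨x, C.2.2.1 (hx ⟨C, hC⟩), fun s => ?_⟩
  obtain ⟨D, hDG, hDs⟩ := hGd (d s) ⟨s, rfl⟩
  exact hDs x (hx ⟨D, hDG⟩)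

lemma Cardinal.mk_finset_lt_continuum {α : Type} (h : Cardinal.mk α < Cardinal.continuum) :
    Cardinal.mk (Finset α) < Cardinal.continuum := by
  cases finite_or_infinite α
  · exact (Cardinal.mk_lt_aleph0).trans Cardinal.aleph0_lt_continuum
  · rwa [Cardinal.mk_finset_of_infinite]

/-- Under Martin's Axiom, one can choose a point in each of continuum many sets of positive
measure so that the chosen subsets of `ℕ` are independent in the sense of density. -/
lemma MartinsAxiom.exists_densityIndependent (hMA : MartinsAxiom) {μ : Measure (ℕ → Bool)}
    [IsFiniteMeasure μ] (hμ : IsCoinMeasure μ) {J : Type}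
    (hJ : Cardinal.mk J = Cardinal.continuum) (K : J → Set (ℕ → Bool))
    (hK : ∀ j, MeasurableSet (K j)) (hK0 : ∀ j, μ (K j) ≠ 0) :
    ∃ x : J → ℕ → Bool, (∀ j, x j ∈ K j) ∧
      DensityIndependent fun j => {n | x j n = true} := by
  classical
  obtain ⟨e⟩ : Nonempty (J ≃ Cardinal.continuum.{0}.ord.ToType) :=
    Cardinal.eq.1 (hJ.trans (Cardinal.mk_ord_toType _).symm)
  let : LinearOrder J := LinearOrder.lift' e e.injective
  have hwf : WellFounded ((· < ·) : J → J → Prop) := InvImage.wf e wellFounded_lt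
  have hIio : ∀ j : J, Cardinal.mk (Iio j) < Cardinal.continuum := fun j => by
    have h1 : Cardinal.mk (Iio (e j)) < Cardinal.continuum := by
      simpa using Cardinal.mk_Iio_lt (e j)
    refine lt_of_le_of_lt (Cardinal.mk_le_of_injective
      (f := fun i : Iio j => (⟨e i.1, i.2⟩ : Iio (e j))) fun a b hab => ?_) h1
    simpa [Subtype.ext_iff] using hab
  have hstep : ∀ (j : J) (y : (i : J) → i < j → ℕ → Bool), ∃ x ∈ K j,
      ∀ s : Finset (Iio j), ∀ d, HasDensity (⋂ i ∈ s, {n | y i.1 i.2 n = true}) d →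
        HasDensity ({n | x n = true} ∩ ⋂ i ∈ s, {n | y i.1 i.2 n = true}) (2⁻¹ * d) := by
    intro j y
    refine hMA.exists_mem_forall (hK j) (hK0 j) (Cardinal.mk_finset_lt_continuum (hIio j))
      fun s => ?_
    by_cases h : ∃ d, HasDensity (⋂ i ∈ s, {n | y i.1 i.2 n = true}) d
    · obtain ⟨d, hd⟩ := h
      filter_upwards [hμ.ae_hasDensity_inter hd] with x hx d' hd'
      rwa [hd'.unique hd]
    · exact .of_forall fun x d hd => absurd ⟨d, hd⟩ h
  choose f hfK hf using hstep
  let x : J → ℕ → Bool := hwf.fix f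
  have hx : ∀ j, x j = f j fun i _ => x i := hwf.fix_eq f
  refine ⟨x, fun j => by rw [hx]; exact hfK _ _, fun s => ?_⟩
  induction s using Finset.induction_on_max with
  | empty => simpa using HasDensity.univ
  | insert a s hs ih =>
    have key := hf a (fun i _ => x i) (s.subtype (· ∈ Iio a)) (2⁻¹ ^ s.card) ?_
    · rw [← hx] at key
      rw [Finset.card_insert_of_notMem fun h => (hs a h).false, pow_succ']
      convert key using 1
      ext n
      simp only [mem_iInter, mem_inter_iff, Finset.mem_insert, Finset.mem_subtype]
      refine ⟨fun h => ⟨h a (.inl rfl), fun i hi => h i (.inr hi)⟩, fun h i hi => ?_⟩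
      obtain rfl | hi := hi
      exacts [h.1, h.2 ⟨i, hs i hi⟩ hi]
    · convert ih using 1
      ext n
      simp only [mem_iInter, Finset.mem_subtype]
      exact ⟨fun h i hi => h ⟨i, hs i hi⟩ hi, fun h i hi => h i hi⟩

/-- The free filter on `ℕ` generated by the cofinite sets and the members of a family. -/
def freeFilterGenerated {κ : Type*} (Y : κ → Set ℕ) : Filter ℕ where
  sets := {A | ∃ s : Finset κ, ∀ᶠ n in cofinite, n ∈ ⋂ k ∈ s, Y k → n ∈ A}
  univ_sets := ⟨∅, by simp⟩
  sets_of_superset := by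
    rintro A B ⟨s, hs⟩ hAB
    exact ⟨s, hs.mono fun n hn h => hAB (hn h)⟩
  inter_sets := by
    classical
    rintro A B ⟨s, hs⟩ ⟨t, ht⟩
    refine ⟨s ∪ t, (hs.and ht).mono fun n hn h => ?_⟩
    simp only [mem_iInter, Finset.mem_union] at hn h
    exact ⟨hn.1 fun k hk => h k (.inl hk), hn.2 fun k hk => h k (.inr hk)⟩

section freeFilterGenerated

variable {κ : Type*} {Y : κ → Set ℕ}

lemma mem_freeFilterGenerated {A : Set ℕ} : A ∈ freeFilterGenerated Y ↔
    ∃ s : Finset κ, ∀ᶠ n in cofinite, n ∈ ⋂ k ∈ s, Y k → n ∈ A :=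
  Iff.rfl

lemma freeFilterGenerated_le_cofinite : freeFilterGenerated Y ≤ cofinite :=
  fun _ hA => ⟨∅, mem_of_superset hA fun _ hn _ => hn⟩

lemma mem_freeFilterGenerated_self (k : κ) : Y k ∈ freeFilterGenerated Y :=
  ⟨{k}, by simp⟩

lemma DensityIndependent.neBot_freeFilterGenerated (hY : DensityIndependent Y) :
    (freeFilterGenerated Y).NeBot := by
  refine ⟨fun h => ?_⟩
  obtain ⟨s, hs⟩ := mem_freeFilterGenerated.1 (empty_mem_iff_bot.2 h)
  have := (hY s).le_of_eventually .empty hs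
  have : (0 : ℝ) < 2⁻¹ ^ s.card := by positivity
  linarith

end freeFilterGenerated

lemma DensityIndependent.comp {J J' : Type*} {Y : J → Set ℕ} (hY : DensityIndependent Y)
    {f : J' → J} (hf : Function.Injective f) : DensityIndependent (Y ∘ f) := by
  intro s
  have := hY (s.map ⟨f, hf⟩)
  simpa using this

lemma DensityIndependent.injective_freeFilterGenerated {ι κ : Type*} [Nonempty κ]
    {Y : ι × κ → Set ℕ} (hY : DensityIndependent Y) :
    Function.Injective fun ξ => freeFilterGenerated fun k => Y (ξ, k) := by
  classical
  intro ξ η h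
  by_contra hne
  obtain ⟨k⟩ := ‹Nonempty κ›
  have hmem := mem_freeFilterGenerated_self (Y := fun k => Y (η, k)) k
  rw [← show freeFilterGenerated (fun k => Y (ξ, k)) = freeFilterGenerated fun k => Y (η, k)
    from h] at hmem
  obtain ⟨s, hs⟩ := mem_freeFilterGenerated.1 hmem
  have h1 := hY (s.map ⟨Prod.mk ξ, Prod.mk_right_injective ξ⟩)
  have h2 := hY (insert (η, k) (s.map ⟨Prod.mk ξ, Prod.mk_right_injective ξ⟩))
  rw [Finset.card_insert_of_notMem (by simp [hne]), pow_succ] at h2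
  have := h1.le_of_eventually h2 (hs.mono fun n hn hns => by simp_all)
  have : (0 : ℝ) < 2⁻¹ ^ (s.map ⟨Prod.mk ξ, Prod.mk_right_injective ξ⟩).card := by positivity
  linarith

/-- If uncountably many of the filters generated by disjoint parts of a density independent family
contain `A`, then `A` cannot have density `1/2`: infinitely many of these filters contain `A`
through intersections of the same length `m`, so that the complement of `A` is almost contained in
sets of density `(1 - 2⁻¹ ^ m) ^ N` for all `N`. -/
lemma DensityIndependent.not_hasDensity_half {ι κ : Type*} {Y : ι × κ → Set ℕ}
    (hY : DensityIndependent Y) {X : Set ι} (hX : ¬ X.Countable) {A : Set ℕ}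
    (hA : ∀ ξ ∈ X, A ∈ freeFilterGenerated fun k => Y (ξ, k)) : ¬ HasDensity A 2⁻¹ := by
  classical
  intro hd
  have hA' : ∀ ξ : X, ∃ s : Finset κ, ∀ᶠ n in cofinite, n ∈ ⋂ k ∈ s, Y (ξ, k) → n ∈ A :=
    fun ξ => hA ξ ξ.2
  choose s hs using hA'
  obtain ⟨m, hm⟩ : ∃ m, {ξ : X | (s ξ).card = m}.Infinite := by
    by_contra! h
    refine hX ((countable_univ_iff (α := X)).1 ?_)
    have : (Set.univ : Set X) = ⋃ m, {ξ : X | (s ξ).card = m} := by ext; simp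
    rw [this]
    exact countable_iUnion fun m => (h m).countable
  let q : ℝ := 1 - 2⁻¹ ^ m
  have hq0 : 0 ≤ q := sub_nonneg.2 (pow_le_one₀ (by norm_num) (by norm_num))
  have hq1 : q < 1 := sub_lt_self _ (by positivity)
  obtain ⟨N, hN⟩ := exists_pow_lt_of_lt_one (show (0 : ℝ) < 2⁻¹ by norm_num) hq1
  obtain ⟨I, hIm, hIN⟩ := hm.exists_subset_card_eq N
  let t : X → Finset (ι × κ) := fun ξ => (s ξ).map ⟨Prod.mk ξ.1, Prod.mk_right_injective ξ.1⟩
  have ht : Pairwise (Function.onFun Disjoint t) := by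
    intro ξ η hne
    refine Finset.disjoint_left.2 fun j hj hj' => hne ?_
    simp only [t, Finset.mem_map, Function.Embedding.coeFn_mk] at hj hj'
    obtain ⟨_, -, rfl⟩ := hj
    obtain ⟨_, -, h⟩ := hj'
    exact Subtype.ext (Prod.ext_iff.1 h).1.symm
  have hdens := hY.inter_compl t ht I ∅ (by simp)
  have hle := hd.compl.le_of_eventually hdens ?_
  · have hprod : ∏ i ∈ I, (1 - (2⁻¹ : ℝ) ^ (t i).card) = q ^ N := by
      rw [← hIN, ← Finset.prod_const]
      refine Finset.prod_congr rfl fun i hi => ?_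
      have : (s i).card = m := hIm hi
      simp [t, q, this]
    rw [hprod] at hle
    norm_num at hle hN
    linarith
  · have hall := (Filter.eventually_all_finset I).2 fun ξ _ => hs ξ
    filter_upwards [hall] with n hn hnA
    simp only [Finset.notMem_empty, iInter_of_empty, iInter_univ, univ_inter, mem_iInter,
      mem_compl_iff, t, Finset.mem_map, Function.Embedding.coeFn_mk] at hn hnA ⊢
    exact fun ξ hξ h => hnA (hn ξ hξ fun k hk => h _ ⟨k, hk, rfl⟩)

/-- A proper filter on `ℕ` meeting every set of positive measure is not measurable. -/
lemma IsCoinMeasure.not_nullMeasurableSet_filterSet {μ : Measure (ℕ → Bool)}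
    (hμ : IsCoinMeasure μ) (hμ0 : μ ≠ 0) {F : Filter ℕ} (hne : F.NeBot)
    (hF : ∀ K, MeasurableSet K → μ K ≠ 0 → (K ∩ filterSet F).Nonempty) :
    ¬ NullMeasurableSet (filterSet F) μ := by
  intro hmeas
  have hae : ∀ᵐ x ∂μ, x ∈ filterSet F := by
    obtain ⟨K, hKF, hK, hKae⟩ := hmeas.compl.exists_measurable_subset_ae_eq
    rw [ae_iff]
    change μ (filterSet F)ᶜ = 0
    rw [← measure_congr hKae]
    by_contra h0
    obtain ⟨x, hxK, hxF⟩ := hF K hK h0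
    exact hKF hxK hxF
  have : (ae μ).NeBot := ae_neBot.2 hμ0
  obtain ⟨x, hx, hx'⟩ := (hae.and (hμ.measurePreserving_not.quasiMeasurePreserving.ae hae)).exists
  refine empty_notMem F (mem_of_superset (inter_mem hx hx') fun n hn => ?_)
  simp_all

lemma mk_measurableSet_le_continuum :
    Cardinal.mk {K : Set (ℕ → Bool) // MeasurableSet K} ≤ Cardinal.continuum := by
  have : MeasurableSpace.CountablyGenerated (ℕ → Bool) := inferInstance
  obtain ⟨b, hb, heq⟩ := this.isCountablyGenerated
  have := MeasurableSpace.cardinal_measurableSet_le_continuum (s := b)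
    (hb.le_aleph0.trans Cardinal.aleph0_le_continuum)
  rw [← heq] at this
  exact this

/-- Fremlin's theorem: under Martin's Axiom there is a family of `2^ℵ₀` many free filters
on `ℕ`, each nonmeasurable with respect to the completed fair-coin product measure `μ`
(i.e. not `μ`-null-measurable), such that the intersection of any uncountably many of them
is `μ`-measurable. -/
theorem MA_exists_nonmeasurable_filters_with_measurable_uncountable_inter
    (hMA : MartinsAxiom) (μ : Measure (ℕ → Bool)) (hμ : IsCoinMeasure μ) :
    ∃ (ι : Type) (F : ι → Filter ℕ),
      Cardinal.mk ι = Cardinal.continuum ∧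
      Function.Injective F ∧
      (∀ ξ : ι, (F ξ).NeBot ∧ F ξ ≤ Filter.cofinite ∧
        ¬ NullMeasurableSet (filterSet (F ξ)) μ) ∧
      ∀ X : Set ι, ¬ X.Countable →
        NullMeasurableSet (⋂ ξ ∈ X, filterSet (F ξ)) μ := by
  have huniv : μ Set.univ = 1 := by simpa using hμ ∅ (fun _ => true)
  have hprob : IsProbabilityMeasure μ := ⟨huniv⟩
  let κ := {K : Set (ℕ → Bool) // MeasurableSet K ∧ μ K ≠ 0}
  have hκ : Nonempty κ := ⟨⟨Set.univ, .univ, by simp⟩⟩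
  have hι : Cardinal.mk (Set ℕ) = Cardinal.continuum := by simp
  have hκc : Cardinal.mk κ ≤ Cardinal.continuum :=
    (Cardinal.mk_le_of_injective (f := fun K : κ =>
      (⟨K.1, K.2.1⟩ : {K : Set (ℕ → Bool) // MeasurableSet K}))
      fun K L h => Subtype.ext (Subtype.mk.inj h)).trans mk_measurableSet_le_continuum
  have hJ : Cardinal.mk (Set ℕ × κ) = Cardinal.continuum := by
    rw [Cardinal.mk_prod, Cardinal.lift_id, Cardinal.lift_id, hι]
    exact Cardinal.mul_eq_left Cardinal.aleph0_le_continuum hκc (Cardinal.mk_ne_zero κ)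
  obtain ⟨x, hxK, hx⟩ := hMA.exists_densityIndependent hμ hJ (fun j => j.2.1)
    (fun j => j.2.2.1) (fun j => j.2.2.2)
  refine ⟨Set ℕ, fun ξ => freeFilterGenerated fun k => {n | x (ξ, k) n = true}, hι,
    hx.injective_freeFilterGenerated, fun ξ => ?_, fun X hX => .of_null ?_⟩
  · have hne := (hx.comp (Prod.mk_right_injective ξ)).neBot_freeFilterGenerated
    refine ⟨hne, freeFilterGenerated_le_cofinite, ?_⟩
    refine hμ.not_nullMeasurableSet_filterSet (IsProbabilityMeasure.ne_zero μ) hne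
      fun K hK hK0 => ?_
    exact ⟨x (ξ, ⟨K, hK, hK0⟩), hxK (ξ, ⟨K, hK, hK0⟩), mem_freeFilterGenerated_self
      (Y := fun k => {n | x (ξ, k) n = true}) ⟨K, hK, hK0⟩⟩
  · have hae := hμ.ae_hasDensity_inter HasDensity.univ
    simp only [inter_univ, mul_one] at hae
    refine measure_mono_null (fun y hy => ?_) (ae_iff.1 hae)
    exact hx.not_hasDensity_half hX fun ξ hξ => mem_iInter₂.1 hy ξ hξ
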